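/- Let Σ be a real symmetric positive semidefinite n×n matrix, let X be a centered Gaussian random vector in ℝⁿ with covariance matrix Σ, and let M be a real symmetric n×n matrix. Set A = Σ^{1/2} M Σ^{1/2}, where Σ^{1/2} is the symmetric positive semidefinite square root of Σ. Then for every x > 0, P( |XᵀMX − E[XᵀMX]| > 2τ(A)x + 2√(tr(A²)) √x ) ≤ 2e^{−x}. -/

import Mathlib

open MeasureTheory ProbabilityTheory Matrix

open Real in
/-- For `g` standard Gaussian, `E[exp (u * g²)] = 1 / √(1 - 2u)`, and this is at most
`exp (u + u² / (1 - 2|u|))`. -/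
lemma inv_sqrt_one_sub_two_mul_le_exp {u : ℝ} (hu : |u| < 1 / 2) :
    (√(1 - 2 * u))⁻¹ ≤ exp (u + u ^ 2 / (1 - 2 * |u|)) := by
  have hpos : 0 < 1 - 2 * u := by linarith [le_abs_self u]
  have hlog : -log (1 - 2 * u) ≤ 2 * (u + u ^ 2 / (1 - 2 * |u|)) := by
    rcases le_total 0 u with h | h
    · rw [abs_of_nonneg h]
      have h1 : 0 ≤ -log (1 - 2 * u) := by
        linarith [log_nonpos hpos.le (by linarith)]
      have h2 := self_le_sinh_iff.2 h1
      rw [sinh_eq, neg_neg, exp_neg, exp_log hpos] at h2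
      refine h2.trans (le_of_eq ?_)
      field_simp
      ring
    · rw [abs_of_nonpos h] at hu ⊢
      have h1 := le_log_one_add_of_nonneg (x := -(2 * u)) (by linarith)
      rw [← sub_eq_add_neg] at h1
      have h2 : 2 * -(2 * u) / (-(2 * u) + 2) = -(2 * u) - 2 * u ^ 2 / (1 - u) := by
        have : 1 - u ≠ 0 := by linarith
        rw [show -(2 * u) + 2 = 2 * (1 - u) by ring]
        field_simp
        ring
      have h3 : u ^ 2 / (1 - u) ≤ u ^ 2 / (1 - 2 * -u) := by
        apply div_le_div_of_nonneg_left (sq_nonneg u) <;> linarith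
      rw [h2, mul_div_assoc] at h1
      linarith
  rw [← exp_log (inv_pos.2 (sqrt_pos.2 hpos)), exp_le_exp, log_inv, log_sqrt hpos.le]
  linarith

open Real in
lemma exp_mul_sq_sub_one_mul_gaussianPDFReal (u y : ℝ) :
    gaussianPDFReal 0 1 y * exp (u * (y ^ 2 - 1)) =
      (√(2 * π))⁻¹ * exp (-u) * exp (-(1 / 2 - u) * y ^ 2) := by
  rw [gaussianPDFReal_def]
  simp only [NNReal.coe_one, mul_one, sub_zero]
  rw [mul_assoc, mul_assoc, ← exp_add, ← exp_add]
  ring_nf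

open Real in
lemma integrable_exp_mul_sq_sub_one_gaussianReal {u : ℝ} (hu : u < 1 / 2) :
    Integrable (fun y ↦ exp (u * (y ^ 2 - 1))) (gaussianReal 0 1) := by
  rw [gaussianReal_of_var_ne_zero 0 one_ne_zero,
    integrable_withDensity_iff_integrable_smul' (measurable_gaussianPDF 0 1)
      (ae_of_all _ fun _ ↦ gaussianPDF_lt_top)]
  simp only [toReal_gaussianPDF, smul_eq_mul, exp_mul_sq_sub_one_mul_gaussianPDFReal]
  exact (integrable_exp_neg_mul_sq (by linarith)).const_mul _

open Real in
lemma integral_exp_mul_sq_sub_one_gaussianReal {u : ℝ} (hu : u < 1 / 2) :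
    ∫ y, exp (u * (y ^ 2 - 1)) ∂(gaussianReal 0 1) = exp (-u) * (√(1 - 2 * u))⁻¹ := by
  rw [integral_gaussianReal_eq_integral_smul one_ne_zero]
  simp only [smul_eq_mul, exp_mul_sq_sub_one_mul_gaussianPDFReal]
  have h : 0 < 1 - 2 * u := by linarith
  have h2 : π / (1 / 2 - u) = 2 * π / (1 - 2 * u) := by
    have : 1 / 2 - u ≠ 0 := by linarith
    field_simp
  rw [integral_const_mul, integral_gaussian, h2, sqrt_div' _ h.le]
  have : √(2 * π) ≠ 0 := by positivity
  field_simp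

section WeightedChiSquare

variable {ι : Type*} [Fintype ι]

open Real in
/-- One-sided deviation inequality for weighted sums of independent centered `χ²₁` variables. -/
lemma measureReal_sum_mul_sq_sub_one_gt_le (a : ι → ℝ) {b x : ℝ} (hb : ∀ i, |a i| ≤ b)
    (hb0 : 0 ≤ b) (hx : 0 < x) :
    (Measure.pi fun _ : ι ↦ gaussianReal 0 1).real
      {y | 2 * b * x + 2 * √(∑ i, a i ^ 2) * √x < ∑ i, a i * (y i ^ 2 - 1)} ≤ exp (-x) := by
  set v := ∑ i, a i ^ 2 with hv
  have hv0 : 0 ≤ v := Finset.sum_nonneg fun i _ ↦ sq_nonneg _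
  rcases hv0.eq_or_lt with h0 | hvpos
  · have ha : ∀ i, a i = 0 := fun i ↦ by
      have := (Finset.sum_eq_zero_iff_of_nonneg fun i _ ↦ sq_nonneg (a i)).1 (hv ▸ h0.symm) i
        (Finset.mem_univ i)
      simpa using this
    have : {y : ι → ℝ | 2 * b * x + 2 * √v * √x < ∑ i, a i * (y i ^ 2 - 1)} = ∅ := by
      ext y
      simp only [ha, zero_mul, Finset.sum_const_zero, Set.mem_ofPred_eq, Set.mem_empty_iff_false,
        iff_false, not_lt]
      positivity
    rw [this]
    simpa using (exp_pos _).le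
  set r := √v with hr
  set s := √x with hs
  have hrpos : 0 < r := sqrt_pos.2 hvpos
  have hspos : 0 < s := sqrt_pos.2 hx
  have hr2 : r ^ 2 = v := sq_sqrt hv0
  have hs2 : s ^ 2 = x := sq_sqrt hx.le
  have hD : 0 < r + 2 * b * s := by positivity
  set t := s / (r + 2 * b * s) with ht
  have htpos : 0 < t := by positivity
  have htb : 1 - 2 * (t * b) = r / (r + 2 * b * s) := by rw [ht]; field_simp; ring
  have htb0 : 0 < 1 - 2 * (t * b) := by rw [htb]; positivity
  have hta : ∀ i, |t * a i| ≤ t * b := fun i ↦ by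
    rw [abs_mul, abs_of_pos htpos]
    exact mul_le_mul_of_nonneg_left (hb i) htpos.le
  have hta2 : ∀ i, t * a i < 1 / 2 := fun i ↦ by linarith [hta i, le_abs_self (t * a i)]
  have hprod : (fun y : ι → ℝ ↦ exp (t * ∑ i, a i * (y i ^ 2 - 1))) =
      fun y ↦ ∏ i, exp ((t * a i) * (y i ^ 2 - 1)) := by
    ext y
    rw [← exp_sum, Finset.mul_sum]
    simp only [mul_assoc]
  have hint : Integrable (fun y : ι → ℝ ↦ exp (t * ∑ i, a i * (y i ^ 2 - 1)))
      (Measure.pi fun _ : ι ↦ gaussianReal 0 1) := by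
    rw [hprod]
    exact Integrable.fintype_prod (f := fun i z ↦ exp ((t * a i) * (z ^ 2 - 1)))
      fun i ↦ integrable_exp_mul_sq_sub_one_gaussianReal (hta2 i)
  have hmgf : mgf (fun y : ι → ℝ ↦ ∑ i, a i * (y i ^ 2 - 1))
      (Measure.pi fun _ : ι ↦ gaussianReal 0 1) t ≤ exp (t ^ 2 * v / (1 - 2 * (t * b))) := by
    rw [mgf, hprod, integral_fintype_prod_eq_prod (fun i z ↦ exp ((t * a i) * (z ^ 2 - 1))), hv,
      Finset.mul_sum, Finset.sum_div, exp_sum]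
    refine Finset.prod_le_prod (fun i _ ↦ integral_nonneg fun _ ↦ (exp_pos _).le) fun i _ ↦ ?_
    rw [integral_exp_mul_sq_sub_one_gaussianReal (hta2 i)]
    refine (mul_le_mul_of_nonneg_left
      (inv_sqrt_one_sub_two_mul_le_exp (by linarith [hta i])) (exp_pos _).le).trans ?_
    rw [← exp_add, exp_le_exp, neg_add_cancel_left, mul_pow]
    exact div_le_div_of_nonneg_left (by positivity) htb0 (by linarith [hta i])
  calc (Measure.pi fun _ : ι ↦ gaussianReal 0 1).real
        {y | 2 * b * x + 2 * r * s < ∑ i, a i * (y i ^ 2 - 1)}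
    _ ≤ (Measure.pi fun _ : ι ↦ gaussianReal 0 1).real
        {y | 2 * b * x + 2 * r * s ≤ ∑ i, a i * (y i ^ 2 - 1)} :=
        measureReal_mono (Set.ofPred_subset_ofPred.2 fun _ hy ↦ hy.le)
    _ ≤ exp (-t * (2 * b * x + 2 * r * s)) * exp (t ^ 2 * v / (1 - 2 * (t * b))) :=
        (measure_ge_le_exp_mul_mgf _ htpos.le hint).trans
          (mul_le_mul_of_nonneg_left hmgf (exp_pos _).le)
    _ = exp (-x) := by
        rw [← exp_add, htb, ← hr2, ← hs2, ht]
        congr 1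
        field_simp
        ring

open Real in
/-- Two-sided deviation inequality for weighted sums of independent centered `χ²₁` variables. -/
lemma measure_abs_sum_mul_sq_sub_one_gt_le (a : ι → ℝ) {b x : ℝ} (hb : ∀ i, |a i| ≤ b)
    (hb0 : 0 ≤ b) (hx : 0 < x) :
    (Measure.pi fun _ : ι ↦ gaussianReal 0 1)
      {y | 2 * b * x + 2 * √(∑ i, a i ^ 2) * √x < |∑ i, a i * (y i ^ 2 - 1)|} ≤
      ENNReal.ofReal (2 * exp (-x)) := by
  have h1 := measureReal_sum_mul_sq_sub_one_gt_le a hb hb0 hx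
  have h2 := measureReal_sum_mul_sq_sub_one_gt_le (fun i ↦ -a i) (b := b) (by simpa using hb)
    hb0 hx
  simp only [neg_sq, neg_mul, Finset.sum_neg_distrib] at h2
  rw [← ofReal_measureReal]
  refine ENNReal.ofReal_le_ofReal ?_
  simp only [lt_abs, Set.ofPred_or]
  linarith [measureReal_union_le (μ := Measure.pi fun _ : ι ↦ gaussianReal 0 1)
    {y | 2 * b * x + 2 * √(∑ i, a i ^ 2) * √x < ∑ i, a i * (y i ^ 2 - 1)}
    {y | 2 * b * x + 2 * √(∑ i, a i ^ 2) * √x < -∑ i, a i * (y i ^ 2 - 1)}]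

lemma integrable_sq_gaussianReal : Integrable (fun y ↦ y ^ 2) (gaussianReal 0 1) :=
  (memLp_id_gaussianReal 2).integrable_sq

lemma integral_sq_gaussianReal : ∫ y, y ^ 2 ∂(gaussianReal 0 1) = 1 := by
  have h := variance_eq_sub (memLp_id_gaussianReal (μ := 0) (v := 1) 2)
  rw [variance_id_gaussianReal] at h
  simpa using h.symm

lemma integral_sum_mul_sq_gaussianReal (a : ι → ℝ) :
    ∫ y, ∑ i, a i * y i ^ 2 ∂(Measure.pi fun _ : ι ↦ gaussianReal 0 1) = ∑ i, a i := by
  rw [integral_finsetSum]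
  · refine Finset.sum_congr rfl fun i _ ↦ ?_
    rw [integral_const_mul, integral_comp_eval (μ := fun _ : ι ↦ gaussianReal 0 1) (i := i)
      (f := fun z : ℝ ↦ z ^ 2) (by fun_prop), integral_sq_gaussianReal, mul_one]
  · exact fun i _ ↦ (integrable_comp_eval (μ := fun _ : ι ↦ gaussianReal 0 1) (i := i)
      integrable_sq_gaussianReal).const_mul _

variable [DecidableEq ι]

lemma Matrix.IsHermitian.trace_mul_self {A : Matrix ι ι ℝ} (hA : A.IsHermitian) :
    (A * A).trace = ∑ i, hA.eigenvalues i ^ 2 := by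
  conv_lhs => rw [hA.spectral_theorem, ← map_mul, Unitary.conjStarAlgAut_apply, trace_mul_cycle,
    Unitary.coe_star_mul_self, one_mul, diagonal_mul_diagonal, trace_diagonal]
  simp [sq]

/-- A real symmetric quadratic form in coordinates with respect to an orthonormal eigenbasis. -/
lemma Matrix.IsHermitian.dotProduct_mulVec_sum_eigenvectorBasis {A : Matrix ι ι ℝ}
    (hA : A.IsHermitian) (y : ι → ℝ) :
    (∑ i, y i • hA.eigenvectorBasis i).ofLp ⬝ᵥ A *ᵥ (∑ i, y i • hA.eigenvectorBasis i).ofLp =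
      ∑ i, hA.eigenvalues i * y i ^ 2 := by
  have h1 : A *ᵥ (∑ i, y i • hA.eigenvectorBasis i).ofLp =
      (∑ i, (hA.eigenvalues i * y i) • hA.eigenvectorBasis i).ofLp := by
    simp only [WithLp.ofLp_sum, WithLp.ofLp_smul, mulVec_sum, mulVec_smul,
      hA.mulVec_eigenvectorBasis, smul_smul, mul_comm]
  have h2 := hA.eigenvectorBasis.orthonormal.inner_sum (fun i ↦ hA.eigenvalues i * y i) y
    Finset.univ
  rw [h1]
  simp only [EuclideanSpace.inner_eq_star_dotProduct, star_trivial] at h2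
  rw [h2]
  refine Finset.sum_congr rfl fun i _ ↦ ?_
  simp
  ring

end WeightedChiSquare

/-- deviation inequality for a quadratic form of a centered Gaussian
vector `X` with covariance `Σ`. Here "`X` is a centered Gaussian vector with
covariance `Σ`" is expressed by saying that the law of `X` is the pushforward of
the law of a vector of independent standard Gaussians under `ω ↦ Σ^{1/2} ω`,
where `S = Σ^{1/2}` is the symmetric positive semidefinite square root of `Σ`.
With `A = Σ^{1/2} M Σ^{1/2}`, `τ(A) = maxᵢ |eigenvalueᵢ(A)|` its spectral radius,
for every `x > 0`:
`P(|XᵀMX − E[XᵀMX]| > 2τ(A)x + 2√(tr(A²)) √x) ≤ 2e^{−x}`. -/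
theorem stmt_9 {Ω : Type*} [MeasurableSpace Ω] (P : Measure Ω) [IsProbabilityMeasure P]
    (n : ℕ) (Sig S M : Matrix (Fin n) (Fin n) ℝ)
    (hSig : Sig.PosSemidef) (hS : S.PosSemidef) (hSsq : S * S = Sig)
    (hM : M.IsHermitian)
    (X : Ω → Fin n → ℝ) (hX : Measurable X)
    (hXlaw : P.map X =
      (Measure.pi fun _ : Fin n => gaussianReal 0 1).map (fun ω => S.mulVec ω))
    (hA : (S * M * S).IsHermitian)
    (x : ℝ) (hx : 0 < x) :
    P {ω : Ω |
        2 * (⨆ i, |hA.eigenvalues i|) * x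
          + 2 * Real.sqrt (((S * M * S) * (S * M * S)).trace) * Real.sqrt x
        < |X ω ⬝ᵥ M.mulVec (X ω) - ∫ ω', X ω' ⬝ᵥ M.mulVec (X ω') ∂P|}
      ≤ ENNReal.ofReal (2 * Real.exp (-x)) := by
  set A := S * M * S
  set μ := Measure.pi fun _ : Fin n ↦ gaussianReal 0 1
  let T : (Fin n → ℝ) → Fin n → ℝ := fun y ↦ (∑ i, y i • hA.eigenvectorBasis i).ofLp
  have hT : Measurable T := by fun_prop
  have hSm : Measurable fun y : Fin n → ℝ ↦ S *ᵥ y :=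
    (Continuous.matrix_mulVec continuous_const continuous_id).measurable
  have hμT : μ.map T = μ := by
    have h1 := (map_pi_eq_stdGaussian (ι := Fin n)).trans
      (stdGaussian_eq_map_pi_orthonormalBasis hA.eigenvectorBasis)
    have h2 := congrArg (Measure.map WithLp.ofLp) h1
    rw [Measure.map_map (by fun_prop) (by fun_prop), Measure.map_map (by fun_prop) (by fun_prop)]
      at h2
    exact h2.symm.trans Measure.map_id
  have hST : Measurable fun y ↦ S *ᵥ T y := hSm.comp hT
  have hlaw : P.map X = μ.map fun y ↦ S *ᵥ T y := by
    rw [hXlaw, ← hμT, Measure.map_map hSm hT, hμT]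
    rfl
  have hq : ∀ y, S *ᵥ T y ⬝ᵥ M *ᵥ (S *ᵥ T y) = ∑ i, hA.eigenvalues i * y i ^ 2 := fun y ↦ by
    rw [← hA.dotProduct_mulVec_sum_eigenvectorBasis y, ← mulVec_mulVec, ← mulVec_mulVec,
      dotProduct_mulVec _ S, ← mulVec_transpose, ← conjTranspose_eq_transpose_of_trivial,
      hS.isHermitian.eq]
  have hQ : Measurable fun z : Fin n → ℝ ↦ z ⬝ᵥ M *ᵥ z :=
    (continuous_id.dotProduct (Continuous.matrix_mulVec continuous_const continuous_id)).measurable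
  have hE : ∫ ω, X ω ⬝ᵥ M *ᵥ X ω ∂P = ∑ i, hA.eigenvalues i := by
    rw [← integral_map (f := fun z ↦ z ⬝ᵥ M *ᵥ z) hX.aemeasurable hQ.aestronglyMeasurable, hlaw,
      integral_map hST.aemeasurable hQ.aestronglyMeasurable]
    simp only [hq]
    exact integral_sum_mul_sq_gaussianReal _
  rw [hE, hA.trace_mul_self]
  set c := 2 * (⨆ i, |hA.eigenvalues i|) * x + 2 * √(∑ i, hA.eigenvalues i ^ 2) * √x
  have hset : MeasurableSet {z : Fin n → ℝ | c < |z ⬝ᵥ M *ᵥ z - ∑ i, hA.eigenvalues i|} :=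
    measurableSet_lt measurable_const (hQ.sub_const _).abs
  change P (X ⁻¹' {z : Fin n → ℝ | c < |z ⬝ᵥ M *ᵥ z - ∑ i, hA.eigenvalues i|}) ≤ _
  rw [← Measure.map_apply hX hset, hlaw, Measure.map_apply hST hset]
  simp only [Set.preimage_ofPred_eq, hq, ← Finset.sum_sub_distrib, ← mul_sub_one]
  exact measure_abs_sum_mul_sq_sub_one_gt_le hA.eigenvalues
    (le_ciSup (Set.finite_range fun i ↦ |hA.eigenvalues i|).bddAbove)
    (Real.iSup_nonneg fun i ↦ abs_nonneg _) hx
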